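/- The function u defined by u(x,t) = f(t−x) + ∫ₓ^{t} w(x,s) f(t−s) ds for 0 ≤ x ≤ t and u(x,t) = 0 for 0 ≤ t < x is a classical solution of the initial-boundary value problem for the wave equation: u is continuously differentiable on [0,∞)×[0,∞), twice continuously differentiable on {(x,t) : 0 < x < t}, satisfies u_tt(x,t) − u_xx(x,t) + q(x) u(x,t) = 0 for 0 < x < t, and satisfies u(x,0) = 0 and u_t(x,0) = 0 for all x > 0 and u(0,t) = f(t) for all t ≥ 0. -/

import Mathlib

open MeasureTheory Set Filter

/-- The triangle `{(x,s) : 0 ≤ x ≤ s}`. -/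
def Dset : Set (ℝ × ℝ) := {p | 0 ≤ p.1 ∧ p.1 ≤ p.2}

/-- The open region `{(x,t) : 0 < x < t}`. -/
def Uset : Set (ℝ × ℝ) := {p | 0 < p.1 ∧ p.1 < p.2}

/-- The solution of the wave equation:
`u(x,t) = f(t-x) + ∫ₓᵗ w(x,s) f(t-s) ds` for `x ≤ t` and `u(x,t) = 0` for `x > t`. -/
noncomputable def usol (f : ℝ → ℝ) (w : ℝ → ℝ → ℝ) (x t : ℝ) : ℝ :=
  if x ≤ t then f (t - x) + ∫ s in x..t, w x s * f (t - s) else 0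


/-- The closed quadrant. -/
def Qd : Set (ℝ × ℝ) := Set.Ici 0 ×ˢ Set.Ici 0

/-- Explicit continuously differentiable functions on the quadrant. -/
structure C1Q (g g1 g2 : ℝ × ℝ → ℝ) : Prop where
  c1 : ContinuousOn g1 Qd
  c2 : ContinuousOn g2 Qd
  hd : ∀ p ∈ Qd, HasFDerivWithinAt g
    (g1 p • ContinuousLinearMap.fst ℝ ℝ ℝ + g2 p • ContinuousLinearMap.snd ℝ ℝ ℝ) Qd p

/-- Convolution type operator. -/
noncomputable def Kop (b : ℝ → ℝ) (a : ℝ × ℝ → ℝ) (p : ℝ × ℝ) : ℝ :=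
  ∫ σ in (0:ℝ)..p.2, a (p.1, p.2 - σ) * b σ

theorem mem_Qd {p : ℝ × ℝ} : p ∈ Qd ↔ 0 ≤ p.1 ∧ 0 ≤ p.2 := by
  exact Iff.rfl

theorem Qd_unique : UniqueDiffOn ℝ Qd :=
  (uniqueDiffOn_Ici 0).prod (uniqueDiffOn_Ici 0)

theorem C1Q.cont {g g1 g2} (h : C1Q g g1 g2) : ContinuousOn g Qd :=
  fun p hp => (h.hd p hp).continuousWithinAt

theorem C1Q.contDiffOn_succ {g g1 g2} (h : C1Q g g1 g2) (n : ℕ)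
    (h1 : ContDiffOn ℝ n g1 Qd) (h2 : ContDiffOn ℝ n g2 Qd) :
    ContDiffOn ℝ (n + 1) g Qd := by
  rw [contDiffOn_succ_iff_hasFDerivWithinAt_of_uniqueDiffOn Qd_unique]
  refine ⟨by simp, _, ?_, h.hd⟩
  exact (h1.smul contDiffOn_const).add (h2.smul contDiffOn_const)

theorem C1Q.contDiffOn_one {g g1 g2} (h : C1Q g g1 g2) : ContDiffOn ℝ 1 g Qd := by
  have := h.contDiffOn_succ 0 (by simpa using h.c1) (by simpa using h.c2)
  simpa using this

theorem C1Q.of_contDiffOn {g : ℝ × ℝ → ℝ} (h : ContDiffOn ℝ 1 g Qd) :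
    C1Q g (fun p => fderivWithin ℝ g Qd p (1, 0)) (fun p => fderivWithin ℝ g Qd p (0, 1)) := by
  have hc := h.continuousOn_fderivWithin Qd_unique le_rfl
  refine ⟨hc.clm_apply continuousOn_const, hc.clm_apply continuousOn_const, fun p hp => ?_⟩
  have := (h.differentiableOn (by norm_num) p hp).hasFDerivWithinAt
  refine this.congr_fderiv ?_
  ext <;> simp

theorem C1Q.add {g g1 g2 k k1 k2} (h : C1Q g g1 g2) (h' : C1Q k k1 k2) :
    C1Q (fun p => g p + k p) (fun p => g1 p + k1 p) (fun p => g2 p + k2 p) := by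
  refine ⟨h.c1.add h'.c1, h.c2.add h'.c2, fun p hp => ?_⟩
  refine HasFDerivWithinAt.congr_fderiv ((h.hd p hp).add (h'.hd p hp)) ?_
  ext <;> simp

theorem C1Q.mul {g g1 g2 k k1 k2} (h : C1Q g g1 g2) (h' : C1Q k k1 k2) :
    C1Q (fun p => g p * k p) (fun p => g1 p * k p + g p * k1 p)
      (fun p => g2 p * k p + g p * k2 p) := by
  refine ⟨(h.c1.mul h'.cont).add (h.cont.mul h'.c1),
    (h.c2.mul h'.cont).add (h.cont.mul h'.c2), fun p hp => ?_⟩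
  refine HasFDerivWithinAt.congr_fderiv ((h.hd p hp).mul (h'.hd p hp)) ?_
  ext <;> simp <;> ring

theorem C1Q.of_snd {b b' : ℝ → ℝ} (hb' : ContinuousOn b' (Ici 0))
    (hb : ∀ y ∈ Ici (0:ℝ), HasDerivWithinAt b (b' y) (Ici 0) y) :
    C1Q (fun p => b p.2) (fun _ => 0) (fun p => b' p.2) := by
  refine ⟨continuousOn_const, hb'.comp continuousOn_snd (fun p hp => (mem_Qd.1 hp).2), ?_⟩
  intro p hp
  have h1 := (hb p.2 (mem_Qd.1 hp).2).hasFDerivWithinAt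
  have h2 : HasFDerivWithinAt (fun p : ℝ × ℝ => p.2) (ContinuousLinearMap.snd ℝ ℝ ℝ) Qd p :=
    hasFDerivWithinAt_snd
  refine HasFDerivWithinAt.congr_fderiv (h1.comp p h2 (fun p hp => (mem_Qd.1 hp).2)) ?_
  ext <;> simp

theorem C1Q.trace {g g1 g2} (h : C1Q g g1 g2) :
    C1Q (fun p => g (p.1, 0)) (fun p => g1 (p.1, 0)) (fun _ => 0) := by
  have hm : MapsTo (fun p : ℝ × ℝ => (p.1, (0:ℝ))) Qd Qd := fun p hp =>
    mem_Qd.2 ⟨(mem_Qd.1 hp).1, le_rfl⟩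
  refine ⟨h.c1.comp (by fun_prop) hm, continuousOn_const, fun p hp => ?_⟩
  have h2 : HasFDerivWithinAt (fun p : ℝ × ℝ => (p.1, (0:ℝ)))
    ((ContinuousLinearMap.fst ℝ ℝ ℝ).prod 0) Qd p :=
    hasFDerivWithinAt_fst.prodMk (hasFDerivWithinAt_const _ _ _)
  refine HasFDerivWithinAt.congr_fderiv ((h.hd _ (hm hp)).comp p h2 hm) ?_
  ext <;> simp

theorem C1Q.hasFDerivAt {g g1 g2} (h : C1Q g g1 g2) {p : ℝ × ℝ} (h1 : 0 < p.1) (h2 : 0 < p.2) :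
    HasFDerivAt g
    (g1 p • ContinuousLinearMap.fst ℝ ℝ ℝ + g2 p • ContinuousLinearMap.snd ℝ ℝ ℝ) p :=
  (h.hd p (mem_Qd.2 ⟨h1.le, h2.le⟩)).hasFDerivAt
    (prod_mem_nhds (Ici_mem_nhds h1) (Ici_mem_nhds h2))

theorem C1Q.deriv_fst {g g1 g2} (h : C1Q g g1 g2) {x y : ℝ} (hx : 0 < x) (hy : 0 ≤ y) :
    HasDerivAt (fun x' => g (x', y)) (g1 (x, y)) x := by
  have h2 : HasDerivWithinAt (fun x' : ℝ => (x', y)) (1, 0) (Ici 0) x :=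
    (hasDerivWithinAt_id x _).prodMk (hasDerivWithinAt_const _ _ _)
  have := (h.hd (x, y) (mem_Qd.2 ⟨hx.le, hy⟩)).comp_hasDerivWithinAt x h2
    (fun z hz => mem_Qd.2 ⟨hz, hy⟩)
  simpa [Function.comp_def] using this.hasDerivAt (Ici_mem_nhds hx)

theorem C1Q.deriv_snd {g g1 g2} (h : C1Q g g1 g2) {x y : ℝ} (hx : 0 ≤ x) (hy : 0 < y) :
    HasDerivAt (fun y' => g (x, y')) (g2 (x, y)) y := by
  have h2 : HasDerivWithinAt (fun y' : ℝ => (x, y')) (0, 1) (Ici 0) y :=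
    (hasDerivWithinAt_const _ _ _).prodMk (hasDerivWithinAt_id y _)
  have := (h.hd (x, y) (mem_Qd.2 ⟨hx, hy.le⟩)).comp_hasDerivWithinAt y h2
    (fun z hz => mem_Qd.2 ⟨hx, hz⟩)
  simpa [Function.comp_def] using this.hasDerivAt (Ici_mem_nhds hy)

/-- Clamping to the quadrant. -/
noncomputable def clampQ (p : ℝ × ℝ) : ℝ × ℝ := (max p.1 0, max p.2 0)

theorem clampQ_cont : Continuous clampQ := by unfold clampQ; fun_prop

theorem clampQ_mem (p) : clampQ p ∈ Qd := mem_Qd.2 ⟨le_max_right _ _, le_max_right _ _⟩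

theorem clampQ_eq {p} (hp : p ∈ Qd) : clampQ p = p := by
  have := mem_Qd.1 hp
  simp [clampQ, this.1, this.2]

theorem clamp_cont {g : ℝ × ℝ → ℝ} (h : ContinuousOn g Qd) : Continuous (fun p => g (clampQ p)) :=
  h.comp_continuous clampQ_cont clampQ_mem

theorem clamp1_cont {b : ℝ → ℝ} (h : ContinuousOn b (Ici 0)) : Continuous (fun y => b (max y 0)) :=
  h.comp_continuous (by fun_prop) (fun y => mem_Ici.2 (le_max_right _ _))

theorem Kop_clamp (b : ℝ → ℝ) (a : ℝ × ℝ → ℝ) {p : ℝ × ℝ} (hp : p ∈ Qd) :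
    Kop b a p = Kop (fun y => b (max y 0)) (fun p => a (clampQ p)) p := by
  have h := mem_Qd.1 hp
  apply intervalIntegral.integral_congr
  intro σ hσ
  rw [uIcc_of_le h.2] at hσ
  have : clampQ (p.1, p.2 - σ) = (p.1, p.2 - σ) :=
    clampQ_eq (mem_Qd.2 ⟨h.1, sub_nonneg.2 hσ.2⟩)
  simp [this, hσ.1]

theorem Kop_continuous {b : ℝ → ℝ} {a : ℝ × ℝ → ℝ} (hb : Continuous b) (ha : Continuous a) :
    Continuous (Kop b a) := by
  unfold Kop
  apply intervalIntegral.continuous_parametric_intervalIntegral_of_continuous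
  · simp only [Function.uncurry_def]; fun_prop
  · fun_prop

theorem Kop_continuousOn {b : ℝ → ℝ} {a : ℝ × ℝ → ℝ} (hb : ContinuousOn b (Ici 0))
    (ha : ContinuousOn a Qd) : ContinuousOn (Kop b a) Qd :=
  (Kop_continuous (clamp1_cont hb) (clamp_cont ha)).continuousOn.congr
    (fun _ hp => Kop_clamp b a hp)

theorem param_deriv {F F' : ℝ → ℝ → ℝ} (hF : Continuous (Function.uncurry F))
    (hF' : Continuous (Function.uncurry F')) {s : Set ℝ} {x a b : ℝ} (hs : s ∈ nhds x)
    (hd : ∀ z ∈ s, ∀ t ∈ uIoc a b, HasDerivAt (fun z => F z t) (F' z t) z) :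
    HasDerivAt (fun z => ∫ t in a..b, F z t) (∫ t in a..b, F' x t) x := by
  obtain ⟨C, hC⟩ := ((isCompact_Icc (a := x - 1) (b := x + 1)).prod
    (isCompact_uIcc (a := a) (b := b))).exists_bound_of_continuousOn hF'.continuousOn
  have hs' : s ∩ Icc (x - 1) (x + 1) ∈ nhds x :=
    inter_mem hs (Icc_mem_nhds (by linarith) (by linarith))
  have e1 : ∀ z, Continuous (F z) := fun z => hF.comp (Continuous.prodMk_right z)
  have e2 : ∀ z, Continuous (F' z) := fun z => hF'.comp (Continuous.prodMk_right z)
  refine (intervalIntegral.hasDerivAt_integral_of_dominated_loc_of_deriv_le (F := F) (F' := F')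
    (bound := fun _ => C) hs' ?_ ?_ ?_ ?_ ?_ ?_).2
  · exact Eventually.of_forall fun z => (e1 z).aestronglyMeasurable
  · exact (e1 x).intervalIntegrable _ _
  · exact (e2 x).aestronglyMeasurable
  · exact Eventually.of_forall fun t ht z hz => hC (z, t) ⟨hz.2, uIoc_subset_uIcc ht⟩
  · exact intervalIntegrable_const
  · exact Eventually.of_forall fun t ht z hz => hd z hz.1 t ht

/-- Derivative of a convolution in one variable. -/
theorem conv_deriv {φ φ' b : ℝ → ℝ} (hφ' : Continuous φ') (hφ : ∀ y, HasDerivAt φ (φ' y) y)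
    (hb : Continuous b) (y : ℝ) :
    HasDerivAt (fun y => ∫ σ in (0:ℝ)..y, φ (y - σ) * b σ)
      (φ 0 * b y + ∫ σ in (0:ℝ)..y, φ' (y - σ) * b σ) y := by
  have hφc : Continuous φ := continuous_iff_continuousAt.2 fun y => (hφ y).continuousAt
  let H : ℝ → ℝ → ℝ := fun y z => ∫ σ in (0:ℝ)..z, φ (y - σ) * b σ
  let H1 : ℝ → ℝ → ℝ →L[ℝ] ℝ := fun y z =>
    ContinuousLinearMap.toSpanSingleton ℝ (∫ σ in (0:ℝ)..z, φ' (y - σ) * b σ)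
  let H2 : ℝ → ℝ → ℝ →L[ℝ] ℝ := fun y z =>
    ContinuousLinearMap.toSpanSingleton ℝ (φ (y - z) * b z)
  have key : HasStrictFDerivAt (Function.uncurry H)
      ((H1 y y).coprod (H2 y y)) (y, y) := by
    refine hasStrictFDerivAt_uncurry_coprod (f := H) (f₁ := H1) (f₂ := H2) (u := (y, y)) ?_ ?_ ?_ ?_
    · refine Eventually.of_forall fun v => ?_
      refine HasDerivAt.hasFDerivAt (f' := ∫ σ in (0:ℝ)..v.2, φ' (v.1 - σ) * b σ) ?_
      refine param_deriv (F := fun y σ => φ (y - σ) * b σ) (F' := fun y σ => φ' (y - σ) * b σ)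
        ?_ ?_ univ_mem ?_
      · simp only [Function.uncurry_def]; fun_prop
      · simp only [Function.uncurry_def]; fun_prop
      · intro z _ t _
        have := (hφ (z - t)).comp_sub_const z t
        exact this.mul_const _
    · refine Eventually.of_forall fun v => ?_
      refine HasDerivAt.hasFDerivAt (f' := φ (v.1 - v.2) * b v.2) ?_
      have hc : Continuous (fun σ => φ (v.1 - σ) * b σ) := by fun_prop
      exact intervalIntegral.integral_hasDerivAt_right (hc.intervalIntegrable _ _)
        hc.aestronglyMeasurable.stronglyMeasurableAtFilter hc.continuousAt
    · have : Continuous (fun v : ℝ × ℝ => ∫ σ in (0:ℝ)..v.2, φ' (v.1 - σ) * b σ) := by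
        apply intervalIntegral.continuous_parametric_intervalIntegral_of_continuous
        · simp only [Function.uncurry_def]; fun_prop
        · fun_prop
      exact ((ContinuousLinearMap.toSpanSingletonCLE (𝕜 := ℝ) (E := ℝ)).continuous.comp
        this).continuousAt
    · have : Continuous (fun v : ℝ × ℝ => φ (v.1 - v.2) * b v.2) := by fun_prop
      exact ((ContinuousLinearMap.toSpanSingletonCLE (𝕜 := ℝ) (E := ℝ)).continuous.comp
        this).continuousAt
  have h2 : HasDerivAt (fun y : ℝ => (y, y)) (1, 1) y :=
    (hasDerivAt_id y).prodMk (hasDerivAt_id y)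
  have := HasFDerivAt.comp_hasDerivAt (f := fun y : ℝ => (y, y)) y key.hasFDerivAt h2
  refine HasDerivAt.congr_deriv this ?_
  simp [H1, H2]
  ring

theorem Kop_deriv_snd {g g1 g2} (h : C1Q g g1 g2) {b : ℝ → ℝ} (hb : ContinuousOn b (Ici 0))
    {x y : ℝ} (hx : 0 ≤ x) (hy : 0 < y) :
    HasDerivAt (fun y => Kop b g (x, y)) (g (x, 0) * b y + Kop b g2 (x, y)) y := by
  let φ' : ℝ → ℝ := fun r => g2 (clampQ (x, r))
  have hφ' : Continuous φ' := (clamp_cont h.c2).comp (Continuous.prodMk_right x)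
  let φ : ℝ → ℝ := fun r => g (x, 0) + ∫ ρ in (0:ℝ)..r, φ' ρ
  have hφ : ∀ r, HasDerivAt φ (φ' r) r := fun r =>
    (intervalIntegral.integral_hasDerivAt_right (hφ'.intervalIntegrable _ _)
        hφ'.aestronglyMeasurable.stronglyMeasurableAtFilter hφ'.continuousAt).const_add _
  have hφeq : ∀ r, 0 ≤ r → φ r = g (x, r) := by
    intro r hr
    have : ∫ ρ in (0:ℝ)..r, φ' ρ = g (x, r) - g (x, 0) := by
      apply intervalIntegral.integral_eq_sub_of_hasDerivAt_of_le hr (f := fun r => g (x, r))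
      · exact h.cont.comp (by fun_prop) (fun z hz => mem_Qd.2 ⟨hx, hz.1⟩)
      · intro z hz
        have e : φ' z = g2 (x, z) := by
          simp only [φ']; rw [clampQ_eq (mem_Qd.2 ⟨hx, hz.1.le⟩)]
        rw [e]
        exact h.deriv_snd hx hz.1
      · exact hφ'.intervalIntegrable _ _
    simp only [φ, this]; ring
  have := conv_deriv hφ' hφ (clamp1_cont hb) y
  have h0 : φ 0 = g (x, 0) := hφeq 0 le_rfl
  have e1 : ∀ y, 0 ≤ y → Kop b g (x, y) = ∫ σ in (0:ℝ)..y, φ (y - σ) * b (max σ 0) := by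
    intro y hy
    apply intervalIntegral.integral_congr
    intro σ hσ
    rw [uIcc_of_le hy] at hσ
    simp only
    rw [hφeq _ (sub_nonneg.2 hσ.2), max_eq_left hσ.1]
  have e2 : Kop b g2 (x, y) = ∫ σ in (0:ℝ)..y, φ' (y - σ) * b (max σ 0) := by
    rw [Kop_clamp b g2 (mem_Qd.2 ⟨hx, hy.le⟩)]
    rfl
  rw [h0, max_eq_left hy.le, ← e2] at this
  refine this.congr_of_eventuallyEq ?_
  filter_upwards [Ioi_mem_nhds hy] with z hz
  exact e1 z (le_of_lt hz)

theorem Kop_deriv_fst {g g1 g2} (h : C1Q g g1 g2) {b : ℝ → ℝ} (hb : ContinuousOn b (Ici 0))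
    {x y : ℝ} (hx : 0 < x) (hy : 0 ≤ y) :
    HasDerivAt (fun x => Kop b g (x, y)) (Kop b g1 (x, y)) x := by
  have hg := clamp_cont h.cont
  have hg1 := clamp_cont h.c1
  have hbc := clamp1_cont hb
  have := param_deriv (F := fun x σ => g (clampQ (x, y - σ)) * b (max σ 0))
    (F' := fun x σ => g1 (clampQ (x, y - σ)) * b (max σ 0)) (s := Ioi 0) (x := x) (a := 0) (b := y)
    (by
      simp only [Function.uncurry_def]
      exact (hg.comp (f := fun p : ℝ × ℝ => (p.1, y - p.2)) (by fun_prop)).mul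
        (hbc.comp continuous_snd))
    (by
      simp only [Function.uncurry_def]
      exact (hg1.comp (f := fun p : ℝ × ℝ => (p.1, y - p.2)) (by fun_prop)).mul
        (hbc.comp continuous_snd))
    (Ioi_mem_nhds hx)
    (by
      intro z hz t ht
      rw [uIoc_of_le hy] at ht
      have hz' : 0 < z := hz
      have hyt : 0 ≤ y - t := sub_nonneg.2 ht.2
      refine HasDerivAt.mul_const ?_ _
      rw [clampQ_eq (mem_Qd.2 ⟨hz'.le, hyt⟩)]
      refine (h.deriv_fst hz' hyt).congr_of_eventuallyEq ?_
      filter_upwards [Ioi_mem_nhds hz'] with w hw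
      rw [clampQ_eq (mem_Qd.2 ⟨le_of_lt (mem_Ioi.1 hw), hyt⟩ : (w, y - t) ∈ Qd)])
  rw [Kop_clamp b g1 (mem_Qd.2 ⟨hx.le, hy⟩)]
  refine this.congr_of_eventuallyEq ?_
  filter_upwards [Ioi_mem_nhds hx] with w hw
  rw [Kop_clamp b g (mem_Qd.2 ⟨le_of_lt (mem_Ioi.1 hw), hy⟩ : (w, y) ∈ Qd)]
  rfl

theorem C1Q.kop {g g1 g2} (h : C1Q g g1 g2) {b : ℝ → ℝ} (hb : ContinuousOn b (Ici 0)) :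
    C1Q (Kop b g) (Kop b g1) (fun p => g (p.1, 0) * b p.2 + Kop b g2 p) := by
  have c1 : ContinuousOn (Kop b g1) Qd := Kop_continuousOn hb h.c1
  have c2 : ContinuousOn (fun p => g (p.1, 0) * b p.2 + Kop b g2 p) Qd :=
    (h.trace.cont.mul (hb.comp continuousOn_snd (fun p hp => (mem_Qd.1 hp).2))).add
      (Kop_continuousOn hb h.c2)
  refine ⟨c1, c2, fun p hp => ?_⟩
  let s : Set (ℝ × ℝ) := Ioi 0 ×ˢ Ioi 0
  have hso : IsOpen s := isOpen_Ioi.prod isOpen_Ioi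
  have hsc : closure s = Qd := by simp [s, Qd, closure_prod_eq]
  have hsQ : s ⊆ Qd := hsc ▸ subset_closure
  have hd : ∀ p ∈ s, HasFDerivAt (Kop b g) (Kop b g1 p • ContinuousLinearMap.fst ℝ ℝ ℝ +
      (g (p.1, 0) * b p.2 + Kop b g2 p) • ContinuousLinearMap.snd ℝ ℝ ℝ) p := by
    intro p hp
    have hn : s ∈ nhds p := hso.mem_nhds hp
    let L : ℝ →L[ℝ] (ℝ →L[ℝ] ℝ) :=
      (ContinuousLinearMap.toSpanSingletonCLE (𝕜 := ℝ) (E := ℝ) : ℝ →L[ℝ] (ℝ →L[ℝ] ℝ))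
    have := hasStrictFDerivAt_uncurry_coprod (𝕜 := ℝ) (f := fun x y => Kop b g (x, y))
      (f₁ := fun x y => ContinuousLinearMap.toSpanSingleton ℝ (Kop b g1 (x, y)))
      (f₂ := fun x y => ContinuousLinearMap.toSpanSingleton ℝ
        (g (x, 0) * b y + Kop b g2 (x, y))) (u := p)
      (by
        filter_upwards [hn] with v hv
        exact (Kop_deriv_fst h hb hv.1 (le_of_lt hv.2)).hasFDerivAt)
      (by
        filter_upwards [hn] with v hv
        exact (Kop_deriv_snd h hb (le_of_lt hv.1) hv.2).hasFDerivAt)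
      ((ContinuousLinearMap.toSpanSingletonCLE (𝕜 := ℝ) (E := ℝ)).continuous.continuousAt.comp
        (c1.continuousAt (mem_of_superset hn hsQ)))
      ((ContinuousLinearMap.toSpanSingletonCLE (𝕜 := ℝ) (E := ℝ)).continuous.continuousAt.comp
        (c2.continuousAt (mem_of_superset hn hsQ)))
    refine (this.hasFDerivAt).congr_fderiv ?_
    ext <;> simp [Function.HasUncurry.uncurry]
  rw [← hsc]
  apply hasFDerivWithinAt_closure_of_tendsto_fderiv
  · exact fun p hp => (hd p hp).differentiableAt.differentiableWithinAt
  · exact (convex_Ioi 0).prod (convex_Ioi 0)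
  · exact hso
  · intro y hy
    exact (Kop_continuousOn hb h.cont y (hsc ▸ hy)).mono hsQ
  · have : ContinuousOn (fun p => Kop b g1 p • ContinuousLinearMap.fst ℝ ℝ ℝ +
      (g (p.1, 0) * b p.2 + Kop b g2 p) • ContinuousLinearMap.snd ℝ ℝ ℝ) Qd :=
      (c1.smul continuousOn_const).add (c2.smul continuousOn_const)
    refine ((this p hp).mono hsQ).tendsto.congr' ?_
    filter_upwards [self_mem_nhdsWithin] with z hz
    exact (hd z hz).fderiv.symm

theorem C1Q.second {g g1 g2 g11 g12 g21 g22} (h : C1Q g g1 g2) (h1 : C1Q g1 g11 g12)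
    (h2 : C1Q g2 g21 g22) : ContDiffOn ℝ 2 g Qd := by
  have := h.contDiffOn_succ 1 (by simpa using h1.contDiffOn_one) (by simpa using h2.contDiffOn_one)
  norm_num at this
  exact this

theorem C1Q.exists_of_contDiffOn_two {g : ℝ × ℝ → ℝ} (h : ContDiffOn ℝ 2 g Qd) :
    ∃ g1 g2 g11 g12 g21 g22, C1Q g g1 g2 ∧ C1Q g1 g11 g12 ∧ C1Q g2 g21 g22 := by
  have hc : ContDiffOn ℝ 1 (fderivWithin ℝ g Qd) Qd :=
    h.fderivWithin Qd_unique (by norm_num)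
  exact ⟨_, _, _, _, _, _, C1Q.of_contDiffOn (h.of_le (by norm_num)),
    C1Q.of_contDiffOn (hc.clm_apply contDiffOn_const),
    C1Q.of_contDiffOn (hc.clm_apply contDiffOn_const)⟩

theorem C1Q.shear_t {g g1 g2} (h : C1Q g g1 g2) {x s : ℝ} (hx : 0 < x) (hs : x < s) :
    HasDerivAt (fun σ => g (x, σ - x)) (g2 (x, s - x)) s :=
  (h.deriv_snd hx.le (sub_pos.2 hs)).comp_sub_const s x

theorem C1Q.shear_x {g g1 g2} (h : C1Q g g1 g2) {x s : ℝ} (hx : 0 < x) (hs : x < s) :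
    HasDerivAt (fun y => g (y, s - y)) (g1 (x, s - x) - g2 (x, s - x)) x := by
  have h2 : HasDerivAt (fun y : ℝ => (y, s - y)) (1, -1) x :=
    (hasDerivAt_id x).prodMk ((hasDerivAt_id x).const_sub s)
  have := HasFDerivAt.comp_hasDerivAt (f := fun y : ℝ => (y, s - y)) x
    (h.hasFDerivAt (p := (x, s - x)) hx (sub_pos.2 hs)) h2
  refine this.congr_deriv ?_
  simp
  ring

theorem second_derivs {g g1 g2 g11 g12 g21 g22} (h : C1Q g g1 g2) (h1 : C1Q g1 g11 g12)
    (h2 : C1Q g2 g21 g22) {v : ℝ → ℝ → ℝ} (hv : ∀ x s, 0 < x → x < s → v x s = g (x, s - x))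
    {x s : ℝ} (hx : 0 < x) (hs : x < s) :
    deriv (deriv (fun σ => v x σ)) s - deriv (deriv (fun y => v y s)) x =
      g12 (x, s - x) + g21 (x, s - x) - g11 (x, s - x) := by
  have e1 : deriv (fun σ => v x σ) =ᶠ[nhds s] fun σ => g2 (x, σ - x) := by
    filter_upwards [Ioi_mem_nhds hs] with σ hσ
    refine ((h.shear_t hx hσ).congr_of_eventuallyEq ?_).deriv
    filter_upwards [Ioi_mem_nhds hσ] with τ hτ
    exact hv x τ hx hτ
  have e2 : deriv (fun y => v y s) =ᶠ[nhds x] fun y => g1 (y, s - y) - g2 (y, s - y) := by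
    filter_upwards [Ioo_mem_nhds hx hs] with y hy
    refine ((h.shear_x hy.1 hy.2).congr_of_eventuallyEq ?_).deriv
    filter_upwards [Ioo_mem_nhds hy.1 hy.2] with z hz
    exact hv z s hz.1 hz.2
  have e3 : deriv (fun y => g1 (y, s - y) - g2 (y, s - y)) x = _ :=
    ((h1.shear_x hx hs).sub (h2.shear_x hx hs)).deriv
  rw [e1.deriv_eq, e2.deriv_eq, (h2.shear_t hx hs).deriv, e3]
  ring

theorem Kop_intervalIntegrable {b : ℝ → ℝ} {a : ℝ × ℝ → ℝ} (hb : ContinuousOn b (Ici 0))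
    (ha : ContinuousOn a Qd) {x y : ℝ} (hx : 0 ≤ x) (hy : 0 ≤ y) :
    IntervalIntegrable (fun σ => a (x, y - σ) * b σ) volume 0 y := by
  apply ContinuousOn.intervalIntegrable
  rw [uIcc_of_le hy]
  refine ContinuousOn.mul ?_ (hb.mono fun z hz => hz.1)
  exact ha.comp (f := fun σ => (x, y - σ)) (by fun_prop)
    (fun z hz => mem_Qd.2 ⟨hx, sub_nonneg.2 hz.2⟩)

theorem Kop_zero (b : ℝ → ℝ) (a : ℝ × ℝ → ℝ) (x : ℝ) : Kop b a (x, 0) = 0 := by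
  simp [Kop]

/-- Gluing by zero across the diagonal. -/
theorem glue_zero {V V1 V2 : ℝ × ℝ → ℝ} (h : C1Q V V1 V2) {u : ℝ × ℝ → ℝ}
    (h1 : ∀ x, 0 ≤ x → V1 (x, 0) = 0) (h2 : ∀ x, 0 ≤ x → V2 (x, 0) = 0)
    (hu : ∀ p : ℝ × ℝ, 0 ≤ p.1 → p.1 ≤ p.2 → u p = V (p.1, p.2 - p.1))
    (hu0 : ∀ p : ℝ × ℝ, 0 ≤ p.1 → p.2 ≤ p.1 → u p = 0) :
    ContDiffOn ℝ 1 u Qd := by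
  let m : ℝ × ℝ → ℝ × ℝ := fun p => (p.1, max (p.2 - p.1) 0)
  have hm : MapsTo m Qd Qd := fun p hp => mem_Qd.2 ⟨(mem_Qd.1 hp).1, le_max_right _ _⟩
  have hmc : Continuous m := by fun_prop
  let L : ℝ × ℝ → (ℝ × ℝ →L[ℝ] ℝ) := fun p =>
    (V1 (m p) - V2 (m p)) • ContinuousLinearMap.fst ℝ ℝ ℝ +
      V2 (m p) • ContinuousLinearMap.snd ℝ ℝ ℝ
  have hL : ContinuousOn L Qd := by
    have c1 := h.c1.comp hmc.continuousOn hm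
    have c2 := h.c2.comp hmc.continuousOn hm
    exact ((c1.sub c2).smul continuousOn_const).add (c2.smul continuousOn_const)
  have key : ContDiffOn ℝ ((0:ℕ) + 1) u Qd := by
    rw [contDiffOn_succ_iff_hasFDerivWithinAt_of_uniqueDiffOn Qd_unique]
    refine ⟨by simp, L, by simpa using hL, fun p hp => ?_⟩
    have hpQ := mem_Qd.1 hp
    let D : Set (ℝ × ℝ) := {p | 0 ≤ p.1 ∧ p.1 ≤ p.2}
    let E : Set (ℝ × ℝ) := {p | 0 ≤ p.1 ∧ p.2 ≤ p.1}
    have hDc : IsClosed D := (isClosed_le continuous_const continuous_fst).inter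
      (isClosed_le continuous_fst continuous_snd)
    have hEc : IsClosed E := (isClosed_le continuous_const continuous_fst).inter
      (isClosed_le continuous_snd continuous_fst)
    have hsub : Qd ⊆ D ∪ E := by
      intro z hz
      have := mem_Qd.1 hz
      rcases le_total z.1 z.2 with h | h
      · exact Or.inl ⟨this.1, h⟩
      · exact Or.inr ⟨this.1, h⟩
    have hD : HasFDerivWithinAt u (L p) D p := by
      by_cases hpD : p ∈ D
      · have hl : HasFDerivWithinAt (fun p : ℝ × ℝ => (p.1, p.2 - p.1))
            ((ContinuousLinearMap.fst ℝ ℝ ℝ).prod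
              (ContinuousLinearMap.snd ℝ ℝ ℝ - ContinuousLinearMap.fst ℝ ℝ ℝ)) D p :=
          hasFDerivWithinAt_fst.prodMk (hasFDerivWithinAt_snd.sub hasFDerivWithinAt_fst)
        have hmaps : MapsTo (fun p : ℝ × ℝ => (p.1, p.2 - p.1)) D Qd := fun z hz =>
          mem_Qd.2 ⟨hz.1, sub_nonneg.2 hz.2⟩
        have hc := (h.hd _ (hmaps hpD)).comp p hl hmaps
        have hmp : m p = (p.1, p.2 - p.1) := by
          simp only [m]; rw [max_eq_left (sub_nonneg.2 hpD.2)]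
        refine HasFDerivWithinAt.congr_fderiv
          (hc.congr (fun z hz => hu z hz.1 hz.2) (hu p hpD.1 hpD.2)) ?_
        simp only [L, hmp]
        ext <;> simp
        ring
      · exact HasFDerivWithinAt.of_notMem_closure (by rwa [hDc.closure_eq])
    have hE : HasFDerivWithinAt u (L p) E p := by
      by_cases hpE : p ∈ E
      · have hmp : m p = (p.1, 0) := by
          simp only [m]; rw [max_eq_right (sub_nonpos.2 hpE.2)]
        have hL0 : L p = 0 := by
          simp only [L, hmp, h1 _ hpE.1, h2 _ hpE.1]
          simp
        rw [hL0]
        exact (hasFDerivWithinAt_const (0:ℝ) p E).congr (fun z hz => hu0 z hz.1 hz.2)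
          (hu0 p hpE.1 hpE.2)
      · exact HasFDerivWithinAt.of_notMem_closure (by rwa [hEc.closure_eq])
    exact (hD.union hE).mono hsub
  simpa using key

/-- With `q` `C¹` on `[0,∞)`, `f` `C²` on `[0,∞)` with `f(0) = f'(0) = 0`, and `w` a `C²`
solution of the Goursat problem, the function `u` is a classical solution of the
initial-boundary value problem for the wave equation: `u` is `C¹` on `[0,∞)×[0,∞)`,
`C²` on `{0 < x < t}`, satisfies `u_tt - u_xx + q u = 0` for `0 < x < t`, the zero
initial conditions `u(x,0) = 0`, `u_t(x,0) = 0` for `x > 0`, and the boundary condition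
`u(0,t) = f(t)` for `t ≥ 0`. -/
theorem wave_classical_solution (q f : ℝ → ℝ) (w : ℝ → ℝ → ℝ)
    (hq : ContDiffOn ℝ 1 q (Set.Ici 0))
    (hf : ContDiffOn ℝ 2 f (Set.Ici 0))
    (hf0 : f 0 = 0) (hf'0 : derivWithin f (Set.Ici 0) 0 = 0)
    (hw : ContDiffOn ℝ 2 (fun p : ℝ × ℝ => w p.1 p.2) Dset)
    (hwpde : ∀ x s : ℝ, 0 < x → x < s →
      deriv (deriv (fun σ => w x σ)) s - deriv (deriv (fun y => w y s)) x
        + q x * w x s = 0)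
    (hw0 : ∀ s : ℝ, 0 ≤ s → w 0 s = 0)
    (hwdiag : ∀ x : ℝ, 0 ≤ x → w x x = -(1/2) * ∫ α in (0:ℝ)..x, q α) :
    ContDiffOn ℝ 1 (fun p : ℝ × ℝ => usol f w p.1 p.2) (Set.Ici 0 ×ˢ Set.Ici 0) ∧
    ContDiffOn ℝ 2 (fun p : ℝ × ℝ => usol f w p.1 p.2) Uset ∧
    (∀ x t : ℝ, 0 < x → x < t →
      deriv (deriv (fun τ => usol f w x τ)) t - deriv (deriv (fun y => usol f w y t)) x
        + q x * usol f w x t = 0) ∧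
    (∀ x : ℝ, 0 < x → usol f w x 0 = 0 ∧ HasDerivAt (fun τ => usol f w x τ) 0 0) ∧
    (∀ t : ℝ, 0 ≤ t → usol f w 0 t = f t) := by
  classical
  let a : ℝ × ℝ → ℝ := fun p => w p.1 (p.1 + p.2)
  have ha : ContDiffOn ℝ 2 a Qd := by
    refine hw.comp (f := fun p : ℝ × ℝ => (p.1, p.1 + p.2)) (by fun_prop) ?_
    intro p hp
    have := mem_Qd.1 hp
    exact ⟨this.1, by simpa using this.2⟩
  obtain ⟨a1, a2, a11, a12, a21, a22, A, A1, A2⟩ := C1Q.exists_of_contDiffOn_two ha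
  let f1 := derivWithin f (Ici 0)
  let f2 := derivWithin f1 (Ici 0)
  have hf1 : ContDiffOn ℝ 1 f1 (Ici 0) := hf.derivWithin (uniqueDiffOn_Ici 0) (by norm_num)
  have hf2 : ContinuousOn f2 (Ici 0) :=
    hf1.continuousOn_derivWithin (uniqueDiffOn_Ici 0) le_rfl
  have hfc := hf.continuousOn
  have F : C1Q (fun p => f p.2) (fun _ => 0) (fun p => f1 p.2) :=
    C1Q.of_snd hf1.continuousOn fun y hy =>
      (hf.differentiableOn (by norm_num) y hy).hasDerivWithinAt
  have F1 : C1Q (fun p => f1 p.2) (fun _ => 0) (fun p => f2 p.2) :=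
    C1Q.of_snd hf2 fun y hy =>
      (hf1.differentiableOn (by norm_num) y hy).hasDerivWithinAt
  have hV := F.add (A.kop hfc)
  have hV1 : C1Q (fun p => 0 + Kop f a1 p) (Kop f a11)
      (fun p => a1 (p.1, 0) * f p.2 + Kop f a12 p) := by
    have := A1.kop hfc
    simpa using this
  have hV2 := F1.add ((A.trace.mul F).add (A2.kop hfc))
  have hVu : ∀ x t : ℝ, x ≤ t → usol f w x t = f (t - x) + Kop f a (x, t - x) := by
    intro x t hxt
    have := intervalIntegral.integral_comp_sub_left (a := 0) (b := t - x)
      (fun s => w x s * f (t - s)) t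
    simp only [sub_sub_cancel, sub_zero] at this
    rw [usol, if_pos hxt, ← this]
    congr 1
    apply intervalIntegral.integral_congr
    intro σ _
    simp only [a]
    congr 2
    ring
  refine ⟨?_, ?_, ?_, ?_, ?_⟩
  · refine glue_zero hV ?_ ?_ ?_ ?_
    · intro x hx
      simp [Kop_zero]
    · intro x hx
      simp [Kop_zero, hf0, f1, hf'0]
    · intro p hp h
      exact hVu p.1 p.2 h
    · intro p hp h
      rcases h.lt_or_eq with h | h
      · exact if_neg (not_le.2 h)
      · show usol f w p.1 p.2 = 0
        rw [hVu p.1 p.2 h.ge, h, sub_self, Kop_zero, hf0, add_zero]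
  · have h2 := hV.second hV1 hV2
    refine (h2.comp (f := fun p : ℝ × ℝ => (p.1, p.2 - p.1)) (s := Uset) (by fun_prop) ?_).congr ?_
    · intro p hp
      exact mem_Qd.2 ⟨hp.1.le, sub_nonneg.2 hp.2.le⟩
    · intro p hp
      exact hVu p.1 p.2 hp.2.le
  · intro x t hx hxt
    have hy : 0 < t - x := sub_pos.2 hxt
    rw [second_derivs hV hV1 hV2 (fun x t _ h => hVu x t h.le) hx hxt, hVu x t hxt.le]
    have ha1 : a1 (x, 0) = -(1/2) * q x := by
      have d1 := A.deriv_fst hx le_rfl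
      have hqc : ContinuousOn q (Ici 0) := hq.continuousOn
      have d2 : HasDerivAt (fun z => -(1/2) * ∫ α in (0:ℝ)..z, q α) (-(1/2) * q x) x := by
        refine HasDerivAt.const_mul _ ?_
        refine intervalIntegral.integral_hasDerivAt_right ?_ ?_ ?_
        · apply ContinuousOn.intervalIntegrable
          rw [uIcc_of_le hx.le]
          exact hqc.mono fun z hz => hz.1
        · exact (hqc.mono Ioi_subset_Ici_self).stronglyMeasurableAtFilter isOpen_Ioi x hx
        · exact hqc.continuousAt (Ici_mem_nhds hx)
      refine d1.unique (d2.congr_of_eventuallyEq ?_)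
      filter_upwards [Ioi_mem_nhds hx] with z hz
      simp only [a, add_zero]
      exact hwdiag z (le_of_lt hz)
    have hpde : ∀ r, 0 < r → a12 (x, r) + a21 (x, r) - a11 (x, r) + q x * a (x, r) = 0 := by
      intro r hr
      have h1 := second_derivs A A1 A2 (v := w) (fun x s _ _ => by simp [a]) hx
        (show x < x + r by linarith)
      have h2 := hwpde x (x + r) hx (by linarith)
      rw [h1] at h2
      simpa using h2
    have hK : Kop f a12 (x, t - x) + Kop f a21 (x, t - x) - Kop f a11 (x, t - x)
        + q x * Kop f a (x, t - x) = 0 := by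
      have i12 := Kop_intervalIntegrable hfc A1.c2 hx.le hy.le
      have i21 := Kop_intervalIntegrable hfc A2.c1 hx.le hy.le
      have i11 := Kop_intervalIntegrable hfc A1.c1 hx.le hy.le
      have i0 := Kop_intervalIntegrable hfc A.cont hx.le hy.le
      simp only [Kop]
      rw [← intervalIntegral.integral_const_mul, ← intervalIntegral.integral_add i12 i21,
        ← intervalIntegral.integral_sub (i12.add i21) i11,
        ← intervalIntegral.integral_add ((i12.add i21).sub i11) (i0.const_mul _)]
      rw [intervalIntegral.integral_of_le hy.le, integral_Ioc_eq_integral_Ioo]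
      refine setIntegral_eq_zero_of_forall_eq_zero fun σ hσ => ?_
      have := hpde (t - x - σ) (sub_pos.2 hσ.2)
      linear_combination f σ * this
    simp only [ha1]
    linear_combination hK
  · intro x hx
    refine ⟨if_neg (not_le.2 hx), ?_⟩
    refine (hasDerivAt_const (0:ℝ) (0:ℝ)).congr_of_eventuallyEq ?_
    filter_upwards [Iio_mem_nhds hx] with τ hτ
    exact if_neg (not_le.2 hτ)
  · intro t ht
    rw [usol, if_pos ht, sub_zero]
    have : ∫ s in (0:ℝ)..t, w 0 s * f (t - s) = ∫ s in (0:ℝ)..t, (0:ℝ) := by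
      apply intervalIntegral.integral_congr
      intro s hs
      rw [uIcc_of_le ht] at hs
      simp [hw0 s hs.1]
    rw [this]
    simp
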